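/- arXiv:0710.0908 — 8 statements merged into one kernel-verified Lean document; each statement's English description precedes it below -/
import Mathlib

section
/- Assume each h_{j,i} (i ∈ A_j) is nondecreasing and the no-free-loop condition holds. Let u, v ∈ ℝ^m satisfy: (a) u_j ≤ v_j for every j ∈ I; (b) for every j with A_j ≠ ∅, u_j ≥ max_{i ∈ A_j} h_{j,i}(u_i); (c) for every j with u_j < v_j, the set A_j is nonempty and v_j = max_{i ∈ A_j} h_{j,i}(v_i). Then u = v, i.e., u_j = v_j for every j ∈ I. -/
/-- If `w l = f l (w (l + 1))` along a finite range, composing all the maps `f l` sends `w n`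
to `w 0`. -/
theorem List.foldr_finRange_apply {α : Type*} (n : ℕ) (f : Fin n → α → α) (w : ℕ → α)
    (hw : ∀ l : Fin n, f l (w (l + 1)) = w l) :
    ((List.finRange n).map f).foldr (fun g z => g z) (w n) = w 0 := by
  induction n generalizing w with
  | zero => rfl
  | succ n ih =>
    have hs := ih (fun l => f l.succ) (fun l => w (l + 1)) (fun l => by simpa using hw l.succ)
    have h0 : f 0 (w 1) = w 0 := by simpa using hw 0
    rw [List.finRange_succ, List.map_cons, List.foldr_cons, List.map_map]
    exact (congrArg (f 0) hs).trans h0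

/-- A self-map of a nonempty finite type has a periodic point. -/
theorem Function.exists_isPeriodicPt_of_finite {α : Type*} [Finite α] [Nonempty α]
    (s : α → α) : ∃ x, ∃ p, 0 < p ∧ Function.IsPeriodicPt s p x := by
  obtain ⟨x⟩ := ‹Nonempty α›
  obtain ⟨a, b, hne, hab⟩ := Finite.exists_ne_map_eq_of_infinite (fun n : ℕ => s^[n] x)
  wlog hlt : a < b generalizing a b
  · exact this b a hne.symm hab.symm (by omega)
  refine ⟨s^[a] x, b - a, by omega, ?_⟩
  change s^[b - a] (s^[a] x) = s^[a] x
  rw [← Function.iterate_add_apply, Nat.sub_add_cancel hlt.le]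
  exact hab.symm


/-- nondecreasing switching functions + the no-free-loop condition,
and vectors `u ≤ v` with `u` satisfying the barrier inequality and `v` sitting
on the barrier (attained maximum) at every index where `u j < v j`; then `u = v`. -/
theorem stmt_1 {m : ℕ} (hm : 1 ≤ m)
    (A : Fin m → Finset (Fin m)) (hA : ∀ j : Fin m, j ∉ A j)
    (h : Fin m → Fin m → ℝ → ℝ)
    (hdiag : ∀ (j : Fin m) (y : ℝ), h j j y = y)
    (hmono : ∀ j i : Fin m, i ∈ A j → Monotone (h j i))
    (hloop : ∀ (k : ℕ) (j : Fin (k + 2) → Fin m),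
      (∀ l : Fin (k + 2), j (l + 1) ∈ A (j l)) →
      ∀ y : ℝ,
        ((List.finRange (k + 2)).map (fun l => h (j l) (j (l + 1)))).foldr
          (fun f z => f z) y < y)
    (u v : Fin m → ℝ)
    (hle : ∀ j : Fin m, u j ≤ v j)
    (hbar : ∀ (j : Fin m) (hne : (A j).Nonempty),
      (A j).sup' hne (fun i => h j i (u i)) ≤ u j)
    (hjump : ∀ j : Fin m, u j < v j →
      ∃ hne : (A j).Nonempty, v j = (A j).sup' hne (fun i => h j i (v i))) :
    u = v := by
  have key : ∀ x : {j // u j < v j}, ∃ y : {j // u j < v j},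
      y.1 ∈ A x.1 ∧ h x.1 y.1 (v y.1) = v x.1 := by
    rintro ⟨j, hj⟩
    obtain ⟨hne, hv⟩ := hjump j hj
    obtain ⟨i, hi, hmax⟩ := (A j).exists_mem_eq_sup' hne (fun i => h j i (v i))
    have hvi : h j i (v i) = v j := (hv.trans hmax).symm
    refine ⟨⟨i, (hle i).lt_of_ne fun heq => ?_⟩, hi, hvi⟩
    have hui : h j i (u i) ≤ u j :=
      (Finset.le_sup' (fun i => h j i (u i)) hi).trans (hbar j hne)
    rw [heq, hvi] at hui
    exact hj.not_ge hui
  choose s hsA hsv using key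
  by_contra huv
  obtain ⟨j₀, hj₀⟩ := Function.ne_iff.mp huv
  have : Nonempty {j // u j < v j} := ⟨⟨j₀, (hle j₀).lt_of_ne hj₀⟩⟩
  obtain ⟨x, p, hp, hper⟩ := Function.exists_isPeriodicPt_of_finite s
  obtain _ | _ | k := p
  · exact absurd hp (lt_irrefl 0)
  · have hx : s x = x := hper
    exact hA x.1 (by simpa only [hx] using hsA x)
  · have hsucc : ∀ l : Fin (k + 2), s^[(l + 1 : Fin (k + 2)).val] x = s (s^[l.val] x) := by
      intro l
      rw [← Function.iterate_succ_apply' s, ← hper.iterate_mod_apply (l.val + 1), Fin.val_add]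
      simp
    have hlt := hloop k (fun l => (s^[l.val] x).1)
      (fun l => by simpa only [hsucc l] using hsA (s^[l.val] x)) (v x.1)
    have hcomp := List.foldr_finRange_apply (k + 2)
      (fun l => h (s^[l.val] x).1 (s^[(l + 1 : Fin (k + 2)).val] x).1)
      (fun n => v (s^[n] x).1)
      (fun l => by
        simpa only [hsucc l, Function.iterate_succ_apply'] using hsv (s^[l.val] x))
    have hx : s^[k + 2] x = x := hper
    simp only [hx, Function.iterate_zero, id_eq] at hcomp
    exact hlt.ne hcomp
end

section
/- Let T > 0 and let y₁, y₂, g₁, g₂ : [0,T] → ℝ be continuous functions with g₁(t) ≥ 0, g₂(t) ≥ 0 and g₁(t) + g₂(t) > 0 for every t ∈ [0,T]. Define a sequence (t_n)_{n ≥ 0} in [0,T] by t₀ = 0 and, for n ≥ 0: t_{2n+1} = inf{ t ∈ [t_{2n}, T] : y₁(t) = y₂(t) − g₁(t) } if this set is nonempty and t_{2n+1} = T otherwise; t_{2n+2} = inf{ t ∈ [t_{2n+1}, T] : y₂(t) = y₁(t) − g₂(t) } if this set is nonempty and t_{2n+2} = T otherwise. Then sup_n t_n = T (equivalently, t_n →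 T as n → ∞). -/
open Filter Topology

/-- The first time `r` in `[a, T]` at which two continuous functions agree (`T` if there is none)
lies in `[a, T]`, and the functions agree at `r` unless `r = T`. -/
theorem ContinuousOn.first_coincidence_mem {u v : ℝ → ℝ} {a T r : ℝ} (haT : a ≤ T)
    (hu : ContinuousOn u (Set.Icc a T)) (hv : ContinuousOn v (Set.Icc a T))
    (hr : ({s | s ∈ Set.Icc a T ∧ u s = v s}.Nonempty →
        r = sInf {s | s ∈ Set.Icc a T ∧ u s = v s}) ∧
      (¬ {s | s ∈ Set.Icc a T ∧ u s = v s}.Nonempty → r = T)) :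
    r ∈ Set.Icc a T ∧ (r = T ∨ u r = v r) := by
  by_cases hne : {s | s ∈ Set.Icc a T ∧ u s = v s}.Nonempty
  · have hclosed : IsClosed {s | s ∈ Set.Icc a T ∧ u s = v s} := by
      have h := (hu.sub hv).preimage_isClosed_of_isClosed isClosed_Icc
        (isClosed_singleton (x := (0 : ℝ)))
      convert h using 1
      ext s
      simp [sub_eq_zero]
    have hmem := hclosed.csInf_mem hne ⟨a, fun s hs => hs.1.1⟩
    rw [← hr.1 hne] at hmem
    exact ⟨hmem.1, Or.inr hmem.2⟩
  · rw [hr.2 hne]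
    exact ⟨⟨haT, le_rfl⟩, Or.inl rfl⟩

/-- Functions continuous on a closed set which agree along a sequence in that set
agree at its limit. -/
theorem ContinuousOn.eq_of_tendsto_of_forall_eq {X Y : Type*} [TopologicalSpace X]
    [TopologicalSpace Y] [T2Space Y] {u v : X → Y} {S : Set X} (hS : IsClosed S)
    (hu : ContinuousOn u S) (hv : ContinuousOn v S) {x : ℕ → X} {l : X}
    (hx : Tendsto x atTop (𝓝 l)) (hxS : ∀ n, x n ∈ S) (huv : ∀ n, u (x n) = v (x n)) :
    u l = v l := by
  have hl : l ∈ S := hS.mem_of_tendsto hx (Eventually.of_forall hxS)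
  have hxw : Tendsto x atTop (𝓝[S] l) :=
    tendsto_nhdsWithin_iff.2 ⟨hx, Eventually.of_forall hxS⟩
  have h := (hu l hl).tendsto.comp hxw
  refine tendsto_nhds_unique h (((hv l hl).tendsto.comp hxw).congr fun n => ?_)
  exact (huv n).symm

/-- pathwise admissibility of the optimal two-mode switching
strategy: for continuous `y₁, y₂` and continuous nonnegative switching costs
`g₁, g₂` with `g₁ + g₂ > 0` on `[0,T]`, the successive hitting times `t n`
(of the barriers `y₁ = y₂ - g₁` and `y₂ = y₁ - g₂`) satisfy `⨆ n, t n = T`. -/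
theorem stmt_2 (T : ℝ) (hT : 0 < T)
    (y₁ y₂ g₁ g₂ : ℝ → ℝ)
    (hy₁ : ContinuousOn y₁ (Set.Icc 0 T)) (hy₂ : ContinuousOn y₂ (Set.Icc 0 T))
    (hg₁ : ContinuousOn g₁ (Set.Icc 0 T)) (hg₂ : ContinuousOn g₂ (Set.Icc 0 T))
    (hg₁nn : ∀ t ∈ Set.Icc (0 : ℝ) T, 0 ≤ g₁ t)
    (hg₂nn : ∀ t ∈ Set.Icc (0 : ℝ) T, 0 ≤ g₂ t)
    (hgpos : ∀ t ∈ Set.Icc (0 : ℝ) T, 0 < g₁ t + g₂ t)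
    (t : ℕ → ℝ) (ht0 : t 0 = 0)
    (hodd : ∀ n : ℕ,
      (({s | s ∈ Set.Icc (t (2 * n)) T ∧ y₁ s = y₂ s - g₁ s}).Nonempty →
        t (2 * n + 1) = sInf {s | s ∈ Set.Icc (t (2 * n)) T ∧ y₁ s = y₂ s - g₁ s}) ∧
      (¬ ({s | s ∈ Set.Icc (t (2 * n)) T ∧ y₁ s = y₂ s - g₁ s}).Nonempty →
        t (2 * n + 1) = T))
    (heven : ∀ n : ℕ,
      (({s | s ∈ Set.Icc (t (2 * n + 1)) T ∧ y₂ s = y₁ s - g₂ s}).Nonempty →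
        t (2 * n + 2) = sInf {s | s ∈ Set.Icc (t (2 * n + 1)) T ∧ y₂ s = y₁ s - g₂ s}) ∧
      (¬ ({s | s ∈ Set.Icc (t (2 * n + 1)) T ∧ y₂ s = y₁ s - g₂ s}).Nonempty →
        t (2 * n + 2) = T)) :
    ⨆ n : ℕ, t n = T := by
  have step_odd : ∀ n, t (2 * n) ∈ Set.Icc 0 T → t (2 * n + 1) ∈ Set.Icc (t (2 * n)) T ∧
      (t (2 * n + 1) = T ∨ y₁ (t (2 * n + 1)) = y₂ (t (2 * n + 1)) - g₁ (t (2 * n + 1))) := by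
    intro n h
    have hsub := Set.Icc_subset_Icc_left (b := T) h.1
    exact ContinuousOn.first_coincidence_mem (v := fun s => y₂ s - g₁ s) h.2 (hy₁.mono hsub)
      ((hy₂.sub hg₁).mono hsub) (hodd n)
  have step_even : ∀ n, t (2 * n + 1) ∈ Set.Icc 0 T → t (2 * n + 2) ∈ Set.Icc (t (2 * n + 1)) T ∧
      (t (2 * n + 2) = T ∨ y₂ (t (2 * n + 2)) = y₁ (t (2 * n + 2)) - g₂ (t (2 * n + 2))) := by
    intro n h
    have hsub := Set.Icc_subset_Icc_left (b := T) h.1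
    exact ContinuousOn.first_coincidence_mem (v := fun s => y₁ s - g₂ s) h.2 (hy₂.mono hsub)
      ((hy₁.sub hg₂).mono hsub) (heven n)
  have step : ∀ n, t n ∈ Set.Icc 0 T → t (n + 1) ∈ Set.Icc (t n) T := by
    intro n h
    obtain ⟨k, rfl | rfl⟩ := n.even_or_odd'
    · exact (step_odd k h).1
    · exact (step_even k h).1
  have hmem : ∀ n, t n ∈ Set.Icc 0 T := by
    intro n
    induction n with
    | zero => simpa [ht0] using hT.le
    | succ n ih => exact ⟨ih.1.trans (step n ih).1, (step n ih).2⟩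
  have hmono : Monotone t := monotone_nat_of_le_succ fun n => (step n (hmem n)).1
  have hbdd : BddAbove (Set.range t) := ⟨T, Set.forall_mem_range.2 fun n => (hmem n).2⟩
  by_cases hreach : ∃ n, t n = T
  · obtain ⟨n, hn⟩ := hreach
    exact le_antisymm (ciSup_le fun k => (hmem k).2) (hn ▸ le_ciSup hbdd n)
  · push Not at hreach
    have hlim : Tendsto t atTop (𝓝 (⨆ n, t n)) := tendsto_atTop_ciSup hmono hbdd
    have hodd_lim : Tendsto (fun n => t (2 * n + 1)) atTop (𝓝 (⨆ n, t n)) :=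
      hlim.comp (tendsto_atTop_mono (fun n => show n ≤ _ by lia) tendsto_id)
    have heven_lim : Tendsto (fun n => t (2 * n + 2)) atTop (𝓝 (⨆ n, t n)) :=
      hlim.comp (tendsto_atTop_mono (fun n => show n ≤ _ by lia) tendsto_id)
    have h₁ := ContinuousOn.eq_of_tendsto_of_forall_eq isClosed_Icc hy₁ (hy₂.sub hg₁) hodd_lim
      (fun n => hmem _) fun n => (step_odd n (hmem _)).2.resolve_left (hreach _)
    have h₂ := ContinuousOn.eq_of_tendsto_of_forall_eq isClosed_Icc hy₂ (hy₁.sub hg₂) heven_lim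
      (fun n => hmem _) fun n => (step_even n (hmem _)).2.resolve_left (hreach _)
    have hpos := hgpos _ (isClosed_Icc.mem_of_tendsto hlim (Eventually.of_forall hmem))
    simp only [Pi.sub_apply] at h₁ h₂
    linarith
end

section
/- Assume the chain condition holds and let y ∈ ℝ^m satisfy the barrier condition. Then there do not exist indices j₁, j₂, j₃ ∈ I with j₂ ∈ A_{j₁} and j₃ ∈ A_{j₂} such that y_{j₁} = h_{j₁,j₂}(y_{j₂}) and y_{j₂} = h_{j₂,j₃}(y_{j₃}). -/
/-- under the chain condition, a vector satisfying the barrier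
condition admits no pair of chained barrier equalities. -/
theorem stmt_3 {m : ℕ} (hm : 1 ≤ m)
    (A : Fin m → Finset (Fin m)) (hA : ∀ j : Fin m, j ∉ A j)
    (h : Fin m → Fin m → ℝ → ℝ)
    (hdiag : ∀ (j : Fin m) (y : ℝ), h j j y = y)
    (hchain : ∀ j i k : Fin m, i ∈ A j → k ∈ A i →
      (k ∈ A j ∨ k = j) ∧ ∀ y : ℝ, h j i (h i k y) < h j k y)
    (y : Fin m → ℝ)
    (hbar : ∀ j : Fin m, ∀ i ∈ A j, h j i (y i) ≤ y j) :
    ¬ ∃ j₁ j₂ j₃ : Fin m, j₂ ∈ A j₁ ∧ j₃ ∈ A j₂ ∧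
      y j₁ = h j₁ j₂ (y j₂) ∧ y j₂ = h j₂ j₃ (y j₃) := by
  rintro ⟨j₁, j₂, j₃, h₁₂, h₂₃, e₁, e₂⟩
  obtain ⟨hmem, hlt⟩ := hchain j₁ j₂ j₃ h₁₂ h₂₃
  have hy : y j₁ < h j₁ j₃ (y j₃) := by
    rw [e₁, e₂]
    exact hlt (y j₃)
  rcases hmem with hmem | rfl
  · exact (hbar j₁ j₃ hmem).not_gt hy
  · rw [hdiag] at hy
    exact hy.false
end

section
/- Assume the chain condition holds and let y ∈ ℝ^m satisfy the barrier condition. Suppose a, b ∈ I with b ∈ A_a and y_a = h_{a,b}(y_b). Then for every j ∈ I with a ∈ A_j one has the strict inequality y_j > h_{j,a}(y_a). -/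
/-- claim (3.22): under the chain condition, if `y` satisfies the
barrier condition and `y a` sits on its barrier at some `b ∈ A a`, then every
mode `j` allowed to switch to `a` is strictly above its barrier at `a`. -/
theorem stmt_4 {m : ℕ} (hm : 1 ≤ m)
    (A : Fin m → Finset (Fin m)) (hA : ∀ j : Fin m, j ∉ A j)
    (h : Fin m → Fin m → ℝ → ℝ)
    (hdiag : ∀ (j : Fin m) (y : ℝ), h j j y = y)
    (hchain : ∀ j i k : Fin m, i ∈ A j → k ∈ A i →
      (k ∈ A j ∨ k = j) ∧ ∀ y : ℝ, h j i (h i k y) < h j k y)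
    (y : Fin m → ℝ)
    (hbar : ∀ j : Fin m, ∀ i ∈ A j, h j i (y i) ≤ y j)
    (a b : Fin m) (hb : b ∈ A a) (hab : y a = h a b (y b)) :
    ∀ j : Fin m, a ∈ A j → h j a (y a) < y j := by
  intro j hj
  obtain ⟨hk, hlt⟩ := hchain j a b hj hb
  rw [hab]
  refine (hlt (y b)).trans_le ?_
  rcases hk with hk | rfl
  · exact hbar j b hk
  · exact (hdiag b (y b)).le
end

section
/- Assume the chain condition holds. Let η, η' ∈ I with η' ∈ A_η, and let y ∈ ℝ^m satisfy y_j ≥ h_{j,k}(y_k) for every j ≠ η and every k ∈ A_j ∖ {η}. Define v ∈ ℝ^m by v_j = y_j for j ≠ η and v_η = h_{η,η'}(y_{η'}). Then v_j ≥ h_{j,k}(v_k) for every j ≠ η and every k ∈ A_j; in particular, for every j with η ∈ A_j one has y_j ≥ h_{j,η}(h_{η,η'}(y_{η'})). -/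
/-- Case 1.1 of Section 3.2, claims (3.16) and (3.7): under the
chain condition, if `y` satisfies the barrier condition at all `j ≠ η` for all
`k ∈ A j ∖ {η}`, and `v` is obtained from `y` by replacing the `η`-th component
by `h η η' (y η')` for some `η' ∈ A η`, then `v` satisfies the full barrier
condition at all `j ≠ η`; in particular `h j η (h η η' (y η')) ≤ y j` whenever
`η ∈ A j`. -/
theorem stmt_5 {m : ℕ} (hm : 1 ≤ m)
    (A : Fin m → Finset (Fin m)) (hA : ∀ j : Fin m, j ∉ A j)
    (h : Fin m → Fin m → ℝ → ℝ)
    (hdiag : ∀ (j : Fin m) (y : ℝ), h j j y = y)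
    (hchain : ∀ j i k : Fin m, i ∈ A j → k ∈ A i →
      (k ∈ A j ∨ k = j) ∧ ∀ y : ℝ, h j i (h i k y) < h j k y)
    (η η' : Fin m) (hη' : η' ∈ A η)
    (y : Fin m → ℝ)
    (hbar : ∀ j : Fin m, j ≠ η → ∀ k ∈ (A j).erase η, h j k (y k) ≤ y j)
    (v : Fin m → ℝ)
    (hv : ∀ j : Fin m, j ≠ η → v j = y j)
    (hvη : v η = h η η' (y η')) :
    (∀ j : Fin m, j ≠ η → ∀ k ∈ A j, h j k (v k) ≤ v j) ∧
    (∀ j : Fin m, η ∈ A j → h j η (h η η' (y η')) ≤ y j) := by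
  have key : ∀ j : Fin m, η ∈ A j → h j η (h η η' (y η')) ≤ y j := by
    intro j hj
    have hjη : j ≠ η := fun e => hA η (e ▸ hj)
    have hη'η : η' ≠ η := fun e => hA η (e ▸ hη')
    obtain ⟨hmem, hlt⟩ := hchain j η η' hj hη'
    refine (hlt (y η')).le.trans ?_
    rcases hmem with hmem | rfl
    · exact hbar j hjη η' (Finset.mem_erase.2 ⟨hη'η, hmem⟩)
    · exact (hdiag η' (y η')).le
  refine ⟨fun j hj k hk => ?_, key⟩
  rw [hv j hj]
  by_cases hkη : k = η
  · subst hkη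
    rw [hvη]
    exact key j hk
  · rw [hv k hkη]
    exact hbar j hj k (Finset.mem_erase.2 ⟨hkη, hk⟩)
end

section
/- Assume the chain condition holds and each h_{j,i} (i ∈ A_j) is nondecreasing. Let η, η' ∈ I with η' ∈ A_η and A_{η'} ≠ ∅, and let y ∈ ℝ^m satisfy y_j ≥ h_{j,k}(y_k) for every j ≠ η' and every k ∈ A_j. Define v ∈ ℝ^m by: v_j = y_j for j ∉ {η, η'}; v_{η'} = max( y_{η'}, max_{k ∈ A_{η'} ∖ {η}} h_{η',k}(y_k) ); and v_η = h_{η,η'}(v_{η'}). Then v_j ≥ h_{j,k}(v_k) for every j ≠ η and every k ∈ A_j. -/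
/-- Case 1.2 of Section 3.2, verification of (3.7) from
(3.17)–(3.18): under the chain condition and monotone switching functions, if
`y` satisfies the barrier condition at all `j ≠ η'`, and `v` is obtained from
`y` by raising the `η'`-th component to
`max (y η') (max_{k ∈ A η' ∖ {η}} h η' k (y k))` and replacing the `η`-th
component by `h η η' (v η')`, then `v` satisfies the barrier condition at all
`j ≠ η`. (The maximum over the empty set is `-∞`, encoded via the `insert`.) -/
theorem stmt_6 {m : ℕ} (hm : 1 ≤ m)
    (A : Fin m → Finset (Fin m)) (hA : ∀ j : Fin m, j ∉ A j)
    (h : Fin m → Fin m → ℝ → ℝ)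
    (hdiag : ∀ (j : Fin m) (y : ℝ), h j j y = y)
    (hmono : ∀ j i : Fin m, i ∈ A j → Monotone (h j i))
    (hchain : ∀ j i k : Fin m, i ∈ A j → k ∈ A i →
      (k ∈ A j ∨ k = j) ∧ ∀ y : ℝ, h j i (h i k y) < h j k y)
    (η η' : Fin m) (hη' : η' ∈ A η) (hAη' : (A η').Nonempty)
    (y : Fin m → ℝ)
    (hbar : ∀ j : Fin m, j ≠ η' → ∀ k ∈ A j, h j k (y k) ≤ y j)
    (v : Fin m → ℝ)
    (hv : ∀ j : Fin m, j ≠ η → j ≠ η' → v j = y j)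
    (hvη' : v η' =
      (insert (y η') (((A η').erase η).image fun k => h η' k (y k))).max'
        (Finset.insert_nonempty _ _))
    (hvη : v η = h η η' (v η')) :
    ∀ j : Fin m, j ≠ η → ∀ k ∈ A j, h j k (v k) ≤ v j := by
  have hraised : ∀ j, j ≠ η' → η' ∈ A j → h j η' (v η') ≤ y j := by
    intro j hj hjη'
    have hmem := Finset.max'_mem
      (insert (y η') (((A η').erase η).image fun k => h η' k (y k)))
      (Finset.insert_nonempty _ _)
    rw [← hvη', Finset.mem_insert, Finset.mem_image] at hmem
    rcases hmem with heq | ⟨k, hk, heq⟩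
    · rw [heq]
      exact hbar j hj η' hjη'
    · obtain ⟨hkj, hlt⟩ := hchain j η' k hjη' (Finset.mem_of_mem_erase hk)
      rw [← heq]
      refine (hlt (y k)).le.trans ?_
      rcases hkj with hkj | rfl
      · exact hbar j hj k hkj
      · exact (hdiag k (y k)).le
  intro j hjη k hk
  by_cases hj : j = η'
  · subst hj
    by_cases hkη : k = η
    · subst hkη
      rw [hvη]
      exact ((hchain j k j hk hη').2 (v j)).le.trans (hdiag j (v j)).le
    · have hkj : k ≠ j := fun e => hA j (e ▸ hk)
      rw [hv k hkη hkj, hvη']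
      apply Finset.le_max'
      exact Finset.mem_insert_of_mem
        (Finset.mem_image.2 ⟨k, Finset.mem_erase.2 ⟨hkη, hk⟩, rfl⟩)
  · rw [hv j hjη hj]
    by_cases hkη' : k = η'
    · subst hkη'
      exact hraised j hj hk
    · by_cases hkη : k = η
      · subst hkη
        obtain ⟨hmem, hlt⟩ := hchain j k η' hk hη'
        rw [hvη]
        exact (hlt (v η')).le.trans
          (hraised j hj (hmem.resolve_right fun e => hj e.symm))
      · rw [hv k hkη hkη']
        exact hbar j hj k hk
end

section
/- Assume each h_{j,i} (i ∈ A_j) is nondecreasing and 1-Lipschitz, i.e., |h_{j,i}(y) − h_{j,i}(ŷ)| ≤ |y − ŷ| for all y, ŷ ∈ ℝ. Let η, η' ∈ I with η' ∈ A_η and A_{η'} ≠ ∅, and let y, ŷ ∈ ℝ^m. Define v ∈ ℝ^m by v_j = y_j for j ∉ {η, η'}, v_{η'} = max( y_{η'}, max_{k ∈ A_{η'} ∖ {η}} h_{η',k}(y_k) ), v_η = h_{η,η'}(v_{η'}); define v̂ from ŷ by the same formulas. Then max_{1 ≤ j ≤ m} |v_j − v̂_j| ≤ max_{j ≠ η}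 |y_j − ŷ_j|. -/
/-- If the data of a finite maximum increase by at most `d`, so does the maximum. -/
theorem max'_insert_image_le_add {ι : Type*} {s : Finset ι} {a b d : ℝ} {f g : ι → ℝ}
    (hab : a ≤ b + d) (hfg : ∀ k ∈ s, f k ≤ g k + d) :
    (insert a (s.image f)).max' (Finset.insert_nonempty _ _) ≤
      (insert b (s.image g)).max' (Finset.insert_nonempty _ _) + d := by
  refine Finset.max'_le _ _ _ fun x hx => ?_
  rcases Finset.mem_insert.mp hx with rfl | hx
  · linarith [Finset.le_max' (insert b (s.image g)) b (Finset.mem_insert_self _ _)]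
  · obtain ⟨k, hk, rfl⟩ := Finset.mem_image.mp hx
    linarith [hfg k hk, Finset.le_max' (insert b (s.image g)) (g k)
      (Finset.mem_insert_of_mem (Finset.mem_image_of_mem g hk))]

/-- A finite maximum is a nonexpansive function of its data. -/
theorem abs_max'_insert_image_sub_le {ι : Type*} {s : Finset ι} {a b d : ℝ} {f g : ι → ℝ}
    (hab : |a - b| ≤ d) (hfg : ∀ k ∈ s, |f k - g k| ≤ d) :
    |(insert a (s.image f)).max' (Finset.insert_nonempty _ _) -
      (insert b (s.image g)).max' (Finset.insert_nonempty _ _)| ≤ d := by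
  have hle := max'_insert_image_le_add (s := s) (f := f) (g := g) (a := a) (b := b) (d := d)
    (by linarith [(abs_le.mp hab).2]) fun k hk => by linarith [(abs_le.mp (hfg k hk)).2]
  have hge := max'_insert_image_le_add (s := s) (f := g) (g := f) (a := b) (b := a) (d := d)
    (by linarith [(abs_le.mp hab).1]) fun k hk => by linarith [(abs_le.mp (hfg k hk)).1]
  exact abs_le.mpr ⟨by linarith, by linarith⟩

/-- stability estimate (3.28) for the construction (3.18): if the
switching functions are nondecreasing and 1-Lipschitz, `η' ∈ A η`, `A η' ≠ ∅`,
and `v, w` are obtained from `y, z` by raising the `η'`-th component to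
`max (y η') (max_{k ∈ A η' ∖ {η}} h η' k (y k))` (resp. for `z`) and replacing
the `η`-th component by `h η η'` of the new `η'`-th component, then
`max_j |v j - w j| ≤ max_{j ≠ η} |y j - z j|`. (The maximum over the empty set
is `-∞`, encoded via the `insert`.) -/
theorem stmt_8 {m : ℕ} (hm : 1 ≤ m)
    (A : Fin m → Finset (Fin m)) (hA : ∀ j : Fin m, j ∉ A j)
    (h : Fin m → Fin m → ℝ → ℝ)
    (hdiag : ∀ (j : Fin m) (y : ℝ), h j j y = y)
    (hmono : ∀ j i : Fin m, i ∈ A j → Monotone (h j i))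
    (hlip : ∀ j i : Fin m, i ∈ A j → ∀ y₁ y₂ : ℝ, |h j i y₁ - h j i y₂| ≤ |y₁ - y₂|)
    (η η' : Fin m) (hη' : η' ∈ A η) (hAη' : (A η').Nonempty)
    (y z v w : Fin m → ℝ)
    (hv0 : ∀ j : Fin m, j ≠ η → j ≠ η' → v j = y j)
    (hw0 : ∀ j : Fin m, j ≠ η → j ≠ η' → w j = z j)
    (hvη' : v η' =
      (insert (y η') (((A η').erase η).image fun k => h η' k (y k))).max'
        (Finset.insert_nonempty _ _))
    (hwη' : w η' =
      (insert (z η') (((A η').erase η).image fun k => h η' k (z k))).max'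
        (Finset.insert_nonempty _ _))
    (hvη : v η = h η η' (v η'))
    (hwη : w η = h η η' (w η')) :
    Finset.univ.sup' ⟨η, Finset.mem_univ η⟩ (fun j => |v j - w j|) ≤
      (Finset.univ.erase η).sup'
        ⟨η', Finset.mem_erase.mpr ⟨fun e => hA η (e ▸ hη'), Finset.mem_univ η'⟩⟩
        (fun j => |y j - z j|) := by
  have hne : η' ≠ η := fun e => hA η (e ▸ hη')
  have hle (j : Fin m) (hj : j ≠ η) : |y j - z j| ≤ (Finset.univ.erase η).sup'
      ⟨η', Finset.mem_erase.mpr ⟨hne, Finset.mem_univ η'⟩⟩ (fun j => |y j - z j|) :=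
    Finset.le_sup' (fun j => |y j - z j|) (Finset.mem_erase.mpr ⟨hj, Finset.mem_univ j⟩)
  have hmax : |v η' - w η'| ≤ (Finset.univ.erase η).sup'
      ⟨η', Finset.mem_erase.mpr ⟨hne, Finset.mem_univ η'⟩⟩ (fun j => |y j - z j|) := by
    rw [hvη', hwη']
    refine abs_max'_insert_image_sub_le (hle η' hne) fun k hk => ?_
    obtain ⟨hkη, hkA⟩ := Finset.mem_erase.mp hk
    exact (hlip η' k hkA _ _).trans (hle k hkη)
  refine Finset.sup'_le _ _ fun j _ => ?_
  rcases eq_or_ne j η with rfl | hj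
  · rw [hvη, hwη]
    exact (hlip _ _ hη' _ _).trans hmax
  rcases eq_or_ne j η' with rfl | hj'
  · exact hmax
  · rw [hv0 j hj hj', hw0 j hj hj']
    exact hle j hj
end

section
/- Let 0 ≤ a < b, let h_{j,i} : [a,b] × ℝ → ℝ be jointly continuous, nondecreasing in the second variable, with h_{j,j}(t,y) = y, and satisfying the chain condition at every t ∈ [a,b] (if i ∈ A_j and k ∈ A_i then k ∈ A_j ∪ {j} and h_{j,i}(t, h_{i,k}(t,y)) < h_{j,k}(t,y) for all y). Let y^1,…,y^m : [a,b] → ℝ be continuous and satisfy the barrier condition at every t: y^j(t) ≥ h_{j,k}(t, y^k(t)) for every j and every k ∈ A_j. Fix ε > 0, let D_ε = { a + lε : l = 0,1,2,… }, and fix η₀ ∈ I with A_{η₀} ≠ ∅. Define recursively τ₀ = a and, for i ≥ 0: (Case 1) if A_{η_i} ≠ ∅, set τ_{i+1} = inf{ t ∈ [τ_i, b] : y^{η_i}(t) = max_{k ∈ A_{η_i}} h_{η_i,k}(t, y^k(t)) } (with τ_{i+1} = b if this set is empty), and let η_{i+1} be the smallest k ∈ A_{η_i} with y^{η_i}(τ_{i+1})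 = h_{η_i,k}(τ_{i+1}, y^k(τ_{i+1})) if τ_{i+1} < b, and the smallest element of A_{η_i} otherwise; (Case 2) if A_{η_i} = ∅ (then i ≥ 1 and A_{η_{i−1}} ≠ ∅), set η_{i+1} = η_{i−1}, and set τ_{i+1} = b if τ_i = b, while if τ_i < b set τ_{i+1} = min(b, τ¹_{i+1}, τ²_{i+1}), where τ¹_{i+1} is the smallest element of D_ε strictly greater than τ_i and τ²_{i+1} = inf{ t ∈ (τ_i, b] : there exists j with η_{i−1} ∈ A_j and y^j(t) = h_{j,η_{i−1}}(t, y^{η_{i−1}}(t)) } (with τ²_{i+1} = +∞ if this set is empty). Then there exists n such that τ_n = b. -/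
open Set Filter Topology

/-- The infimum of the grid points `a + l ε` beyond `x` is itself such a grid point. -/
lemma exists_nat_sInf_grid_eq (a x : ℝ) {ε : ℝ} (hε : 0 < ε) :
    ∃ l : ℕ, sInf {t | (∃ l : ℕ, t = a + (l : ℝ) * ε) ∧ x < t} = a + (l : ℝ) * ε ∧
      x < a + (l : ℝ) * ε := by
  classical
  have hex : ∃ l : ℕ, x < a + (l : ℝ) * ε := by
    obtain ⟨n, hn⟩ := exists_nat_gt ((x - a) / ε)
    rw [div_lt_iff₀ hε] at hn
    exact ⟨n, by linarith⟩
  refine ⟨Nat.find hex, IsLeast.csInf_eq ⟨⟨⟨_, rfl⟩, Nat.find_spec hex⟩, ?_⟩, Nat.find_spec hex⟩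
  rintro _ ⟨⟨l, rfl⟩, hl⟩
  have : ((Nat.find hex : ℕ) : ℝ) ≤ l := by exact_mod_cast Nat.find_min' hex hl
  gcongr

/-- A later grid point lies at least one mesh size further. -/
lemma grid_add_le_of_lt {a ε : ℝ} (hε : 0 < ε) {k l : ℕ}
    (hkl : a + (k : ℝ) * ε < a + (l : ℝ) * ε) : a + (k : ℝ) * ε + ε ≤ a + (l : ℝ) * ε := by
  have hlt : (k : ℝ) < l := lt_of_mul_lt_mul_right (by linarith) hε.le
  have hle : (k : ℝ) + 1 ≤ l := by exact_mod_cast hlt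
  nlinarith

/-- The times in `[a, b]` at which the path `y` sits on the barrier `g (·, z ·)` form a closed
set. -/
lemma isClosed_setOf_eq_barrier {a b : ℝ} {y z : ℝ → ℝ} {g : ℝ → ℝ → ℝ}
    (hg : ContinuousOn (fun p : ℝ × ℝ => g p.1 p.2) (Icc a b ×ˢ (univ : Set ℝ)))
    (hy : ContinuousOn y (Icc a b)) (hz : ContinuousOn z (Icc a b)) :
    IsClosed {t | t ∈ Icc a b ∧ y t = g t (z t)} := by
  have hgz : ContinuousOn (fun t => g t (z t)) (Icc a b) :=
    hg.comp (f := fun t => (t, z t)) (continuousOn_id.prodMk hz) fun t ht => ⟨ht, mem_univ _⟩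
  have := (hy.sub hgz).preimage_isClosed_of_isClosed isClosed_Icc (isClosed_singleton (x := 0))
  convert this using 1
  ext t
  simp [sub_eq_zero]

/-- Given finitely many pairs of closed sets, none of which has the limit of a sequence in both
members, the tail of the sequence does not meet both members of any pair. -/
lemma eventually_atTop_not_mem_pair {ι X : Type*} [Finite ι] [TopologicalSpace X]
    {u : ℕ → X} {x : X} (hu : Tendsto u atTop (𝓝 x)) {F G : ι → Set X}
    (hF : ∀ i, IsClosed (F i)) (hG : ∀ i, IsClosed (G i))
    (hFG : ∀ i, ¬ (x ∈ F i ∧ x ∈ G i)) :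
    ∃ N, ∀ i, ∀ k ≥ N, ∀ l ≥ N, u k ∈ F i → u l ∉ G i := by
  have hev : ∀ i, ∀ᶠ N in atTop, ∀ k ≥ N, ∀ l ≥ N, u k ∈ F i → u l ∉ G i := by
    intro i
    by_cases hx : x ∈ F i
    · have hx' : x ∈ (G i)ᶜ := fun hxG => hFG i ⟨hx, hxG⟩
      exact (eventually_forall_ge_atTop.2 (hu.eventually ((hG i).isOpen_compl.mem_nhds hx'))).mono
        fun N hN k _ l hl _ => hN l hl
    · exact (eventually_forall_ge_atTop.2 (hu.eventually ((hF i).isOpen_compl.mem_nhds hx))).mono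
        fun N hN k hk l _ hkF => absurd hkF (hN k hk)
  exact (eventually_all.2 hev).exists

/-- pathwise content of the key claim in the proof of Theorem 3.6:
with time-dependent switching functions `h j i : [a,b] × ℝ → ℝ` (jointly
continuous, nondecreasing in `y`, `h j j t y = y`, satisfying the chain
condition at every `t ∈ [a,b]`) and continuous paths `Y j` satisfying the
barrier condition at every `t ∈ [a,b]`, the recursively defined approximately
optimal switching strategy `(τ i, η i)` (Case 1 when `A (η i) ≠ ∅`: hit the
barrier of mode `η i` and switch to the smallest optimal index; Case 2 when
`A (η i) = ∅`: go back to `η (i-1)` and stop at the next point of the ε-grid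
`D_ε = {a + lε}` or the next time some mode `j` with `η (i-1) ∈ A j` sits on
its barrier at `η (i-1)`) reaches the terminal time `b` in finitely many steps. -/
theorem stmt_9 {m : ℕ} (hm : 1 ≤ m)
    (A : Fin m → Finset (Fin m)) (hA : ∀ j : Fin m, j ∉ A j)
    (a b : ℝ) (ha : 0 ≤ a) (hab : a < b)
    (h : Fin m → Fin m → ℝ → ℝ → ℝ)
    (hcont : ∀ j i : Fin m,
      ContinuousOn (fun p : ℝ × ℝ => h j i p.1 p.2)
        (Set.Icc a b ×ˢ (Set.univ : Set ℝ)))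
    (hmono : ∀ j i : Fin m, ∀ t ∈ Set.Icc a b, Monotone (h j i t))
    (hdiag : ∀ (j : Fin m) (t y : ℝ), h j j t y = y)
    (hchain : ∀ j i k : Fin m, ∀ t ∈ Set.Icc a b, i ∈ A j → k ∈ A i →
      (k ∈ A j ∨ k = j) ∧ ∀ y : ℝ, h j i t (h i k t y) < h j k t y)
    (Y : Fin m → ℝ → ℝ)
    (hYcont : ∀ j : Fin m, ContinuousOn (Y j) (Set.Icc a b))
    (hbar : ∀ t ∈ Set.Icc a b, ∀ j : Fin m, ∀ k ∈ A j, h j k t (Y k t) ≤ Y j t)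
    (ε : ℝ) (hε : 0 < ε)
    (η : ℕ → Fin m) (τ : ℕ → ℝ)
    (hη0 : (A (η 0)).Nonempty) (hτ0 : τ 0 = a)
    -- Case 1: `A (η i) ≠ ∅`
    (hcase1 : ∀ i : ℕ, ∀ hne : (A (η i)).Nonempty,
      (({t | t ∈ Set.Icc (τ i) b ∧
          Y (η i) t = (A (η i)).sup' hne fun k => h (η i) k t (Y k t)}).Nonempty →
        τ (i + 1) = sInf {t | t ∈ Set.Icc (τ i) b ∧
          Y (η i) t = (A (η i)).sup' hne fun k => h (η i) k t (Y k t)}) ∧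
      (¬ ({t | t ∈ Set.Icc (τ i) b ∧
          Y (η i) t = (A (η i)).sup' hne fun k => h (η i) k t (Y k t)}).Nonempty →
        τ (i + 1) = b) ∧
      η (i + 1) ∈ A (η i) ∧
      (τ (i + 1) < b →
        Y (η i) (τ (i + 1)) =
          h (η i) (η (i + 1)) (τ (i + 1)) (Y (η (i + 1)) (τ (i + 1))) ∧
        ∀ k ∈ A (η i),
          Y (η i) (τ (i + 1)) = h (η i) k (τ (i + 1)) (Y k (τ (i + 1))) →
            η (i + 1) ≤ k) ∧
      (¬ τ (i + 1) < b → ∀ k ∈ A (η i), η (i + 1) ≤ k))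
    -- Case 2: `A (η i) = ∅`
    (hcase2 : ∀ i : ℕ, A (η i) = ∅ →
      η (i + 1) = η (i - 1) ∧
      (τ i = b → τ (i + 1) = b) ∧
      (τ i < b →
        (({t | t ∈ Set.Ioc (τ i) b ∧ ∃ j : Fin m, η (i - 1) ∈ A j ∧
            Y j t = h j (η (i - 1)) t (Y (η (i - 1)) t)}).Nonempty →
          τ (i + 1) = min b
            (min (sInf {t | (∃ l : ℕ, t = a + (l : ℝ) * ε) ∧ τ i < t})
              (sInf {t | t ∈ Set.Ioc (τ i) b ∧ ∃ j : Fin m, η (i - 1) ∈ A j ∧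
                Y j t = h j (η (i - 1)) t (Y (η (i - 1)) t)}))) ∧
        (¬ ({t | t ∈ Set.Ioc (τ i) b ∧ ∃ j : Fin m, η (i - 1) ∈ A j ∧
            Y j t = h j (η (i - 1)) t (Y (η (i - 1)) t)}).Nonempty →
          τ (i + 1) = min b (sInf {t | (∃ l : ℕ, t = a + (l : ℝ) * ε) ∧ τ i < t})))) :
    ∃ n : ℕ, τ n = b := by
  by_contra! hne
  set Z : Fin m → Fin m → Set ℝ := fun p q => {t | t ∈ Icc a b ∧ Y p t = h p q t (Y q t)}
  have hZclosed : ∀ p q, IsClosed (Z p q) := fun p q =>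
    isClosed_setOf_eq_barrier (hcont p q) (hYcont p) (hYcont q)
  have hZchain : ∀ p q r, q ∈ A p → r ∈ A q → ∀ t, ¬ (t ∈ Z p q ∧ t ∈ Z q r) := by
    rintro p q r hq hr t ⟨⟨ht, hpq⟩, -, hqr⟩
    obtain ⟨hrp, hlt⟩ := hchain p q r t ht hq hr
    have hlt := hlt (Y r t)
    rw [← hqr, ← hpq] at hlt
    rcases hrp with hrp | rfl
    · exact hlt.not_ge (hbar t ht p r hrp)
    · rw [hdiag] at hlt
      exact lt_irrefl _ hlt
  have hstep : ∀ i, τ i < b → τ i ≤ τ (i + 1) ∧ τ (i + 1) ≤ b := by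
    intro i hi
    rcases (A (η i)).eq_empty_or_nonempty with he | he
    · obtain ⟨-, -, h2⟩ := hcase2 i he
      obtain ⟨h2, h2'⟩ := h2 hi
      obtain ⟨l, hl, hlt⟩ := exists_nat_sInf_grid_eq a (τ i) hε
      rw [hl] at h2 h2'
      by_cases hS : ({t | t ∈ Ioc (τ i) b ∧ ∃ j : Fin m, η (i - 1) ∈ A j ∧
            Y j t = h j (η (i - 1)) t (Y (η (i - 1)) t)}).Nonempty
      · rw [h2 hS]
        exact ⟨le_min hi.le (le_min hlt.le (le_csInf hS fun t ht => ht.1.1.le)), min_le_left _ _⟩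
      · rw [h2' hS]
        exact ⟨le_min hi.le hlt.le, min_le_left _ _⟩
    · obtain ⟨h1, h1', -⟩ := hcase1 i he
      by_cases hS : ({t | t ∈ Icc (τ i) b ∧
          Y (η i) t = (A (η i)).sup' he fun k => h (η i) k t (Y k t)}).Nonempty
      · rw [h1 hS]
        obtain ⟨t, ht⟩ := hS
        exact ⟨le_csInf ⟨t, ht⟩ fun t ht => ht.1.1,
          (csInf_le ⟨τ i, fun t ht => ht.1.1⟩ ht).trans ht.1.2⟩
      · rw [h1' hS]
        exact ⟨hi.le, le_rfl⟩
  have hlt : ∀ i, τ i < b := by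
    intro i
    induction i with
    | zero => rwa [hτ0]
    | succ i ih => exact lt_of_le_of_ne (hstep i ih).2 (hne _)
  have hτmono : Monotone τ := monotone_nat_of_le_succ fun i => (hstep i (hlt i)).1
  have hIcc : ∀ i, τ i ∈ Icc a b := fun i => ⟨hτ0 ▸ hτmono (Nat.zero_le i), (hlt i).le⟩
  have hswitch : ∀ i, (A (η i)).Nonempty →
      η (i + 1) ∈ A (η i) ∧ τ (i + 1) ∈ Z (η i) (η (i + 1)) := by
    intro i he
    obtain ⟨-, -, hmem, heq, -⟩ := hcase1 i he
    exact ⟨hmem, hIcc _, (heq (hlt _)).1⟩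
  have hreturn : ∀ i, A (η i) = ∅ →
      (∃ l : ℕ, τ (i + 1) = a + (l : ℝ) * ε ∧ τ i < τ (i + 1)) ∨
        ∃ p, η (i - 1) ∈ A p ∧ τ (i + 1) ∈ Z p (η (i - 1)) := by
    intro i he
    obtain ⟨-, -, h2⟩ := hcase2 i he
    obtain ⟨h2, h2'⟩ := h2 (hlt i)
    obtain ⟨l, hl, hil⟩ := exists_nat_sInf_grid_eq a (τ i) hε
    rw [hl] at h2 h2'
    have hb := hlt (i + 1)
    set S := {t | t ∈ Ioc (τ i) b ∧ ∃ j : Fin m, η (i - 1) ∈ A j ∧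
      Y j t = h j (η (i - 1)) t (Y (η (i - 1)) t)}
    by_cases hS : S.Nonempty
    · have hτ := h2 hS
      rcases min_choice b (min (a + (l : ℝ) * ε) (sInf S)) with hm1 | hm1
      · exact absurd (hτ.trans hm1) hb.ne
      rcases min_choice (a + (l : ℝ) * ε) (sInf S) with hm2 | hm2
      · have hτl := hτ.trans (hm1.trans hm2)
        exact Or.inl ⟨l, hτl, hτl ▸ hil⟩
      · right
        have hcl : IsClosed (⋃ p ∈ {p | η (i - 1) ∈ A p}, Z p (η (i - 1))) :=
          (toFinite _).isClosed_biUnion fun p _ => hZclosed p _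
        have hsub : S ⊆ ⋃ p ∈ {p | η (i - 1) ∈ A p}, Z p (η (i - 1)) := by
          rintro t ⟨ht, p, hp, heq⟩
          exact mem_biUnion (show p ∈ {p | η (i - 1) ∈ A p} from hp)
            ⟨⟨(hIcc i).1.trans ht.1.le, ht.2⟩, heq⟩
        have hinf := closure_minimal hsub hcl
          (csInf_mem_closure hS ⟨τ i, fun t ht => ht.1.1.le⟩)
        rw [← hm2, ← hm1, ← hτ] at hinf
        simpa using hinf
    · have hτ := h2' hS
      rcases min_choice b (a + (l : ℝ) * ε) with hm1 | hm1
      · exact absurd (hτ.trans hm1) hb.ne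
      · exact Or.inl ⟨l, hτ.trans hm1, (hτ.trans hm1) ▸ hil⟩
  have hbdd : BddAbove (range τ) := ⟨b, by rintro _ ⟨i, rfl⟩; exact (hlt i).le⟩
  have hlim := tendsto_atTop_ciSup hτmono hbdd
  obtain ⟨N₁, hN₁⟩ := eventually_atTop_not_mem_pair
    (ι := {x : Fin m × Fin m × Fin m // x.2.1 ∈ A x.1 ∧ x.2.2 ∈ A x.2.1}) hlim
    (F := fun x => Z x.1.1 x.1.2.1) (G := fun x => Z x.1.2.1 x.1.2.2)
    (fun x => hZclosed _ _) (fun x => hZclosed _ _) (fun x => hZchain _ _ _ x.2.1 x.2.2 _)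
  have hsep : ∀ p q r, q ∈ A p → r ∈ A q → ∀ k ≥ N₁, ∀ l ≥ N₁, τ k ∈ Z p q → τ l ∉ Z q r :=
    fun p q r hq hr => hN₁ ⟨(p, q, r), hq, hr⟩
  obtain ⟨N₂, hN₂⟩ := eventually_atTop.1
    (hlim.eventually (lt_mem_nhds (sub_lt_self (⨆ i, τ i) hε)))
  have hgrid : ∀ i ≥ N₁, (A (η i)).Nonempty → (A (η (i + 2))).Nonempty ∧
      ∃ l : ℕ, τ (i + 2) = a + (l : ℝ) * ε ∧ τ (i + 1) < τ (i + 2) := by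
    intro i hi he
    obtain ⟨hmem, hon⟩ := hswitch i he
    rcases (A (η (i + 1))).eq_empty_or_nonempty with he' | he'
    · refine ⟨(hcase2 (i + 1) he').1 ▸ he, (hreturn (i + 1) he').resolve_right ?_⟩
      rintro ⟨p, hp, hp'⟩
      exact hsep _ _ _ hp hmem (i + 2) (by omega) (i + 1) (by omega) hp' hon
    · obtain ⟨hmem', hon'⟩ := hswitch (i + 1) he'
      exact absurd hon' (hsep _ _ _ hmem hmem' (i + 1) (by omega) (i + 2) (by omega) hon)
  have hrec : ∀ i, (A (η i)).Nonempty ∨ (A (η (i + 1))).Nonempty := by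
    intro i
    induction i with
    | zero => exact Or.inl hη0
    | succ i ih =>
      rcases (A (η (i + 1))).eq_empty_or_nonempty with he | he
      · right
        rw [(hcase2 (i + 1) he).1]
        exact ih.resolve_right (by simp [he])
      · exact Or.inl he
  obtain ⟨i, hi₁, hi₂, he⟩ : ∃ i, N₁ ≤ i ∧ N₂ ≤ i ∧ (A (η i)).Nonempty := by
    rcases hrec (max N₁ N₂) with he | he
    · exact ⟨_, le_max_left _ _, le_max_right _ _, he⟩
    · exact ⟨max N₁ N₂ + 1, by omega, by omega, he⟩
  obtain ⟨he', k, hk, -⟩ := hgrid i hi₁ he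
  obtain ⟨-, l, hl, hjump⟩ := hgrid (i + 2) (by omega) he'
  have hkl : τ (i + 2) < τ (i + 2 + 2) := (hτmono (by omega)).trans_lt hjump
  have hmesh := grid_add_le_of_lt hε (hk ▸ hl ▸ hkl)
  have hnear := hN₂ (i + 2) (by omega)
  have hle := le_ciSup hbdd (i + 2 + 2)
  linarith
end
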